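/- Let n ≥ 1 be an integer, let Q be a real symmetric n×n matrix, and set g(λ) = 2·⟨λ, Qλ⟩ − H_n[λ]. Suppose there exists NO pair of vectors λ, ν ∈ ℝ^n satisfying simultaneously: (i) 4·(Qλ)_j − (4/n)·λ_j·log(λ_j) − ν_j = 0 for all 0 ≤ j ≤ n−1 (with 0·log 0 = 0); (ii) 0 < ‖λ‖₂² < n; (iii) λ_j ≥ 0 for all j; (iv) λ_j·ν_j = 0 for all j; (v) ν_j ≥ 0 for all j. Then g(λ) ≥ 0 for every λ ∈ ℝ^n with λ_j ≥ 0 for all j and ∑_{j=0}^{n−1} λ_j² = 1. -/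

import Mathlib

/-- The entropy functional `H_n[λ] = (1/n)·∑_k λ_k²·log(n·λ_k²/‖λ‖₂²)`
(convention `0·log 0 = 0`, automatic since `Real.log 0 = 0`). -/
noncomputable def entropyH (n : ℕ) (l : Fin n → ℝ) : ℝ :=
  (1 / n : ℝ) * ∑ k : Fin n, l k ^ 2 * Real.log (n * l k ^ 2 / ∑ j : Fin n, l j ^ 2)

open Filter Topology in
lemma hasDerivAt_sqlog (x : ℝ) :
    HasDerivAt (fun y : ℝ => y ^ 2 * Real.log y) (2 * (x * Real.log x) + x) x := by
  rcases eq_or_ne x 0 with rfl | hx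
  · rw [hasDerivAt_iff_tendsto_slope]
    have h : Tendsto (fun y : ℝ => y * Real.log y) (𝓝[≠] 0) (𝓝 0) := by
      have := (Real.continuous_mul_log.tendsto 0).mono_left (nhdsWithin_le_nhds (s := {0}ᶜ))
      simpa using this
    have h2 : (2 * ((0:ℝ) * Real.log 0) + 0) = 0 := by simp
    rw [h2]
    refine h.congr' ?_
    filter_upwards [self_mem_nhdsWithin] with y hy
    have hy' : y ≠ 0 := hy
    simp [slope_def_field]
    field_simp
  · have := (hasDerivAt_pow 2 x).fun_mul (Real.hasDerivAt_log hx)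
    refine this.congr_deriv ?_
    have e : x ^ 2 * x⁻¹ = x := by field_simp
    rw [e]
    norm_num
    ring

/-- reduced functional -/
noncomputable def redP (n : ℕ) (Q : Matrix (Fin n) (Fin n) ℝ) (l : Fin n → ℝ) : ℝ :=
  2 * (∑ j : Fin n, l j * Q.mulVec l j) - (2 / n : ℝ) * ∑ j : Fin n, l j ^ 2 * Real.log (l j)

lemma redP_sphere (n : ℕ) (hn : 1 ≤ n) (Q : Matrix (Fin n) (Fin n) ℝ) (l : Fin n → ℝ)
    (hS : ∑ j : Fin n, l j ^ 2 = 1) :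
    2 * (∑ j : Fin n, l j * Q.mulVec l j) - entropyH n l = redP n Q l - Real.log n / n := by
  have hn0 : (n : ℝ) ≠ 0 := by positivity
  have h : ∀ k, l k ^ 2 * Real.log (n * l k ^ 2 / ∑ j : Fin n, l j ^ 2)
      = l k ^ 2 * Real.log n + 2 * (l k ^ 2 * Real.log (l k)) := by
    intro k
    rw [hS, div_one]
    rcases eq_or_ne (l k) 0 with h0 | h0
    · simp [h0]
    · rw [Real.log_mul hn0 (by positivity), Real.log_pow]; push_cast; ring
  unfold entropyH redP
  rw [Finset.sum_congr rfl (fun k _ => h k), Finset.sum_add_distrib, ← Finset.sum_mul, hS,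
    ← Finset.mul_sum]
  field_simp
  ring

lemma redP_continuous (n : ℕ) (Q : Matrix (Fin n) (Fin n) ℝ) : Continuous (redP n Q) := by
  have h : Continuous (fun y : ℝ => y ^ 2 * Real.log y) :=
    continuous_iff_continuousAt.2 fun x => (hasDerivAt_sqlog x).continuousAt
  unfold redP
  have h2 : ∀ j : Fin n, Continuous fun l : Fin n → ℝ => l j ^ 2 * Real.log (l j) :=
    fun j => h.comp (continuous_apply j)
  have h3 : ∀ j : Fin n, Continuous fun l : Fin n → ℝ => l j * Q.mulVec l j := by
    intro j
    simp only [Matrix.mulVec, dotProduct]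
    fun_prop
  exact (continuous_const.mul (continuous_finsetSum _ fun j _ => h3 j)).sub
    (continuous_const.mul (continuous_finsetSum _ fun j _ => h2 j))

lemma compact_sphere (n : ℕ) :
    IsCompact {l : Fin n → ℝ | (∀ j, 0 ≤ l j) ∧ ∑ j : Fin n, l j ^ 2 = 1} := by
  apply (isCompact_Icc (a := (0 : Fin n → ℝ)) (b := 1)).of_isClosed_subset
  · apply IsClosed.inter
    · have : {l : Fin n → ℝ | ∀ j, 0 ≤ l j} = Set.Ici 0 := by ext; simp [Pi.le_def]
      change IsClosed {l : Fin n → ℝ | ∀ j, 0 ≤ l j}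
      rw [this]
      exact isClosed_Ici
    · exact isClosed_eq (by fun_prop) continuous_const
  · rintro l ⟨h0, h1⟩
    refine ⟨h0, fun j => ?_⟩
    have := Finset.single_le_sum (f := fun j => l j ^ 2) (fun i _ => sq_nonneg _)
      (Finset.mem_univ j)
    simp only [h1] at this
    simp only [Pi.one_apply]
    nlinarith [h0 j]

lemma redP_smul (n : ℕ) (Q : Matrix (Fin n) (Fin n) ℝ) (l : Fin n → ℝ) (t : ℝ) (ht : 0 < t) :
    redP n Q (t • l) = t ^ 2 * (redP n Q l - (2 / n) * (∑ j, l j ^ 2) * Real.log t) := by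
  have h : ∀ k, (t • l) k ^ 2 * Real.log ((t • l) k)
      = t ^ 2 * (l k ^ 2 * Real.log t + (l k ^ 2 * Real.log (l k))) := by
    intro k
    simp only [Pi.smul_apply, smul_eq_mul]
    rcases eq_or_ne (l k) 0 with h0 | h0
    · simp [h0]
    · rw [Real.log_mul ht.ne' h0]; ring
  have h2 : ∀ k, (t • l) k * Q.mulVec (t • l) k = t ^ 2 * (l k * Q.mulVec l k) := by
    intro k
    rw [Matrix.mulVec_smul]
    simp only [Pi.smul_apply, smul_eq_mul]; ring
  unfold redP
  rw [Finset.sum_congr rfl (fun k _ => h k), Finset.sum_congr rfl (fun k _ => h2 k),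
    ← Finset.mul_sum, ← Finset.mul_sum, Finset.sum_add_distrib, ← Finset.sum_mul]
  ring

lemma redP_lower (n : ℕ) (Q : Matrix (Fin n) (Fin n) ℝ) (p : ℝ)
    (hp : ∀ l : Fin n → ℝ, (∀ j, 0 ≤ l j) → ∑ j, l j ^ 2 = 1 → p ≤ redP n Q l)
    (l : Fin n → ℝ) (hl : ∀ j, 0 ≤ l j) :
    0 ≤ redP n Q l + (1 / n) * ((∑ j, l j ^ 2) * Real.log (∑ j, l j ^ 2))
      - p * ∑ j, l j ^ 2 := by
  have hS0 : 0 ≤ ∑ j, l j ^ 2 := Finset.sum_nonneg fun i _ => sq_nonneg _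
  rcases hS0.eq_or_lt with h | h
  · have hz : l = 0 := by
      funext j
      have := (Finset.sum_eq_zero_iff_of_nonneg (fun i _ => sq_nonneg (l i))).1 h.symm j
        (Finset.mem_univ j)
      simpa using this
    subst hz
    simp [redP]
  · set S := ∑ j, l j ^ 2 with hS
    set r := Real.sqrt S with hr
    have hr0 : 0 < r := Real.sqrt_pos.2 h
    have hr2 : r ^ 2 = S := Real.sq_sqrt hS0
    have hu : ∑ j, (r⁻¹ • l) j ^ 2 = 1 := by
      simp only [Pi.smul_apply, smul_eq_mul, mul_pow, ← Finset.mul_sum]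
      rw [← hS, ← hr2]; field_simp
    have h1 := hp (r⁻¹ • l) (fun j => mul_nonneg (by positivity) (hl j)) hu
    have h2 := redP_smul n Q (r⁻¹ • l) r hr0
    rw [smul_inv_smul₀ hr0.ne', hu, hr2] at h2
    have h3 : Real.log S = 2 * Real.log r := by rw [← hr2, Real.log_pow]; norm_num
    rw [h2, h3]
    have := mul_le_mul_of_nonneg_left h1 hS0
    have e : S * (redP n Q (r⁻¹ • l) - 2 / n * 1 * Real.log r) + 1 / n * (S * (2 * Real.log r))
      - p * S = S * redP n Q (r⁻¹ • l) - S * p := by ring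
    rw [e]; linarith

lemma deriv_Phi (n : ℕ) (Q : Matrix (Fin n) (Fin n) ℝ) (hQ : Q.IsSymm) (p : ℝ)
    (m : Fin n → ℝ) (hm : ∑ j, m j ^ 2 = 1) (j : Fin n) :
    HasDerivAt (fun s : ℝ => redP n Q (m + s • Pi.single j 1)
      + (1 / n) * ((∑ i, (m + s • Pi.single j 1 : Fin n → ℝ) i ^ 2)
        * Real.log (∑ i, (m + s • Pi.single j 1 : Fin n → ℝ) i ^ 2))
      - p * ∑ i, (m + s • Pi.single j 1 : Fin n → ℝ) i ^ 2)
      (4 * Q.mulVec m j - (4 / n : ℝ) * (m j * Real.log (m j)) - 2 * p * m j) 0 := by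
  set v : Fin n → ℝ := Pi.single j 1 with hv
  have hvsum : ∀ f : Fin n → ℝ, ∑ i, f i * v i = f j := by
    intro f
    simp [hv, Pi.single_apply]
  have hc : ∀ i, HasDerivAt (fun s : ℝ => (m + s • v) i) (v i) 0 := by
    intro i
    simpa using ((hasDerivAt_id (0:ℝ)).mul_const (v i)).const_add (m i)
  have hc' : ∀ i, HasDerivAt (fun s : ℝ => Q.mulVec (m + s • v) i) (Q.mulVec v i) 0 := by
    intro i
    simp only [Matrix.mulVec_add, Matrix.mulVec_smul]
    simpa using ((hasDerivAt_id (0:ℝ)).mul_const (Q.mulVec v i)).const_add (Q.mulVec m i)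
  have hz : ∀ i, (m + (0:ℝ) • v) i = m i := by intro i; simp
  have hS : HasDerivAt (fun s : ℝ => ∑ i, (m + s • v) i ^ 2) (2 * m j) 0 := by
    have := HasDerivAt.fun_sum (u := Finset.univ) (fun i _ => (hc i).fun_pow 2)
    refine this.congr_deriv ?_
    rw [← hvsum (fun i => 2 * m i)]
    exact Finset.sum_congr rfl fun i _ => by simp
  have hS1 : ∑ i, (m + (0:ℝ) • v) i ^ 2 = 1 := by simpa using hm
  have hL : HasDerivAt (fun s : ℝ => (∑ i, (m + s • v) i ^ 2) *
      Real.log (∑ i, (m + s • v) i ^ 2)) (2 * m j) 0 := by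
    have := hS.fun_mul (hS.log (by rw [hS1]; norm_num))
    refine this.congr_deriv ?_
    rw [hS1]; simp
  have hE : HasDerivAt (fun s : ℝ => ∑ i, (m + s • v) i ^ 2 * Real.log ((m + s • v) i))
      (2 * (m j * Real.log (m j)) + m j) 0 := by
    have := HasDerivAt.fun_sum (u := Finset.univ)
      (fun i _ => (hasDerivAt_sqlog ((m + (0:ℝ) • v) i)).comp (0:ℝ) (hc i))
    refine this.congr_deriv ?_
    rw [← hvsum (fun i => 2 * (m i * Real.log (m i)) + m i)]
    exact Finset.sum_congr rfl fun i _ => by rw [hz]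
  have hB : HasDerivAt (fun s : ℝ => ∑ i, (m + s • v) i * Q.mulVec (m + s • v) i)
      (2 * Q.mulVec m j) 0 := by
    have := HasDerivAt.fun_sum (u := Finset.univ) (fun i _ => (hc i).fun_mul (hc' i))
    refine this.congr_deriv ?_
    rw [Finset.sum_add_distrib]
    have e1 : ∑ i, v i * Q.mulVec (m + (0:ℝ) • v) i = Q.mulVec m j := by
      rw [← hvsum (Q.mulVec m)]
      exact Finset.sum_congr rfl fun i _ => by simp [mul_comm]
    have e2 : ∑ i, (m + (0:ℝ) • v) i * Q.mulVec v i = Q.mulVec m j := by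
      simp only [hz]
      change m ⬝ᵥ Q.mulVec v = _
      rw [Matrix.dotProduct_mulVec, ← Matrix.mulVec_transpose, hQ.eq]
      exact hvsum _
    rw [e1, e2]; ring
  have := (((hB.const_mul 2).fun_sub (hE.const_mul (2 / n : ℝ))).fun_add
    (hL.const_mul (1 / n : ℝ))).fun_sub (hS.const_mul p)
  refine this.congr_deriv ?_
  ring

open Filter Topology in
lemma deriv_nonneg_of_min {f : ℝ → ℝ} {d : ℝ} (hf : HasDerivAt f d 0) (h0 : f 0 = 0)
    (h : ∀ s, 0 ≤ s → 0 ≤ f s) : 0 ≤ d := by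
  have h1 := hf.hasDerivWithinAt (s := Set.Ioi 0)
  rw [hasDerivWithinAt_iff_tendsto_slope' (by simp)] at h1
  refine ge_of_tendsto h1 ?_
  filter_upwards [self_mem_nhdsWithin] with s hs
  have hs' : (0:ℝ) < s := hs
  rw [slope_def_field, h0]
  simp only [sub_zero]
  exact div_nonneg (h s hs'.le) hs'.le

/-- KKT criterion: if the modified KKT system
`4(Qλ)_j − (4/n)λ_j log λ_j − ν_j = 0`, `0 < ‖λ‖₂² < n`, `λ_j ≥ 0`, `λ_jν_j = 0`, `ν_j ≥ 0`
has no solution, then `g(λ) = 2⟨λ,Qλ⟩ − H_n[λ] ≥ 0` on the nonnegative unit sphere. -/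
theorem kkt_no_solution_implies_nonneg (n : ℕ) (hn : 1 ≤ n)
    (Q : Matrix (Fin n) (Fin n) ℝ) (hQ : Q.IsSymm)
    (hnosol : ¬ ∃ (l ν : Fin n → ℝ),
      (∀ j, 4 * Q.mulVec l j - (4 / n : ℝ) * (l j * Real.log (l j)) - ν j = 0) ∧
      (0 < ∑ j : Fin n, l j ^ 2) ∧ ((∑ j : Fin n, l j ^ 2) < n) ∧
      (∀ j, 0 ≤ l j) ∧ (∀ j, l j * ν j = 0) ∧ (∀ j, 0 ≤ ν j)) :
    ∀ l : Fin n → ℝ, (∀ j, 0 ≤ l j) → (∑ j : Fin n, l j ^ 2) = 1 →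
      0 ≤ 2 * (∑ j : Fin n, l j * Q.mulVec l j) - entropyH n l := by
  intro l₀ hl₀ hS₀
  by_contra hneg
  push Not at hneg
  rw [redP_sphere n hn Q l₀ hS₀] at hneg
  obtain ⟨m, ⟨hm0, hm1⟩, hmin⟩ := (compact_sphere n).exists_isMinOn ⟨l₀, hl₀, hS₀⟩
    (redP_continuous n Q).continuousOn
  have hmin' : ∀ l : Fin n → ℝ, (∀ j, 0 ≤ l j) → ∑ j, l j ^ 2 = 1 → redP n Q m ≤ redP n Q l :=
    fun l h1 h2 => hmin ⟨h1, h2⟩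
  have hn0 : (0 : ℝ) < n := by exact_mod_cast hn
  set p := redP n Q m with hp
  have hpn : n * p < Real.log n := by
    have h1 := hmin' l₀ hl₀ hS₀
    have h2 : p < Real.log n / n := by linarith
    rw [lt_div_iff₀ hn0] at h2
    linarith
  have hlow := redP_lower n Q p hmin'
  set d : Fin n → ℝ := fun j =>
    4 * Q.mulVec m j - (4 / n : ℝ) * (m j * Real.log (m j)) - 2 * p * m j with hd
  have hd0 : ∀ j, 0 ≤ d j := by
    intro j
    refine deriv_nonneg_of_min (deriv_Phi n Q hQ p m hm1 j) ?_ ?_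
    · simp [hm1, ← hp]
    · intro s hs
      apply hlow
      intro i
      have : (0:ℝ) ≤ (Pi.single j 1 : Fin n → ℝ) i := by
        rw [Pi.single_apply]; split_ifs <;> norm_num
      have := mul_nonneg hs this
      simpa using add_nonneg (hm0 i) this
  have hdm : ∀ j, m j * d j = 0 := by
    intro j
    rcases (hm0 j).eq_or_lt with h | h
    · rw [← h, zero_mul]
    · have : d j = 0 := by
        refine IsLocalMin.hasDerivAt_eq_zero ?_ (deriv_Phi n Q hQ p m hm1 j)
        have hev : ∀ᶠ s : ℝ in nhds 0, -m j < s := lt_mem_nhds (by linarith)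
        filter_upwards [hev] with s hs
        have e0 := hlow (m + s • Pi.single j 1) (by
          intro i
          rcases eq_or_ne i j with rfl | hij
          · simp; linarith
          · simp [hij, hm0 i])
        refine le_trans (le_of_eq ?_) e0
        simp [hm1, ← hp]
      rw [this, mul_zero]
  set t := Real.exp (n * p / 2) with ht
  have ht0 : 0 < t := Real.exp_pos _
  have hlt : Real.log t = n * p / 2 := Real.log_exp _
  have hsum : ∑ j, (t • m) j ^ 2 = t ^ 2 := by
    simp only [Pi.smul_apply, smul_eq_mul, mul_pow, ← Finset.mul_sum, hm1, mul_one]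
  refine hnosol ⟨t • m, t • d, ?_, ?_, ?_, ?_, ?_, ?_⟩
  · intro j
    rw [Matrix.mulVec_smul]
    simp only [Pi.smul_apply, smul_eq_mul, hd]
    rcases eq_or_ne (m j) 0 with h0 | h0
    · simp [h0]; ring
    · rw [Real.log_mul ht0.ne' h0, hlt]
      field_simp
      ring
  · rw [hsum]; positivity
  · rw [hsum, ht, ← Real.exp_nat_mul, ← Real.lt_log_iff_exp_lt hn0]
    push_cast
    linarith
  · exact fun j => mul_nonneg ht0.le (hm0 j)
  · intro j
    simp only [Pi.smul_apply, smul_eq_mul]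
    have := hdm j
    linear_combination t ^ 2 * this
  · exact fun j => mul_nonneg ht0.le (hd0 j)
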